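/- In any 2-tone 6-coloring of the Heawood graph, there do not exist distinct colors a, b, c, d in {1,…,6} such that all four labels {a,b}, {c,d}, {a,c}, {b,d} appear on vertices lying in the same partite set of the bipartition of the Heawood graph. -/

import Mathlib

/-- A `t`-tone `k`-coloring of a simple graph `G` assigns to each vertex a `t`-element
subset of `{1, …, k}` so that any two distinct vertices `u`, `v` share fewer than
`d(u,v)` colors (vertices at infinite distance impose no constraint). -/
def IsTToneColoring {V : Type*} (G : SimpleGraph V) (t k : ℕ) (f : V → Finset ℕ) : Prop :=
  (∀ v, (f v).card = t ∧ f v ⊆ Finset.Icc 1 k) ∧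
  ∀ u v : V, u ≠ v → ((f u ∩ f v).card : ℕ∞) < G.edist u v

/-- The `t`-tone chromatic number: the least `k` admitting a `t`-tone `k`-coloring. -/
noncomputable def toneNumber {V : Type*} (G : SimpleGraph V) (t : ℕ) : ℕ :=
  sInf {k | ∃ f : V → Finset ℕ, IsTToneColoring G t k f}
/-- The Heawood graph on vertex set `ℤ/14ℤ`: each `i` is adjacent to `i + 1` and `i - 1`,
and each even `i` is adjacent to `i + 5`. -/
def heawoodGraph : SimpleGraph (ZMod 14) :=
  SimpleGraph.fromRel (fun i j => j = i + 1 ∨ (Even i.val ∧ j = i + 5))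

def hAdj (i j : Fin 14) : Prop :=
  i ≠ j ∧ ((j = i + 1 ∨ (i.val % 2 = 0 ∧ j = i + 5)) ∨ (i = j + 1 ∨ (j.val % 2 = 0 ∧ i = j + 5)))

instance : DecidableRel hAdj := fun i j => by unfold hAdj; infer_instance

theorem hAdj_iff (i j : ZMod 14) : heawoodGraph.Adj i j ↔ hAdj i j := by
  unfold heawoodGraph hAdj
  rw [SimpleGraph.fromRel_adj, Nat.even_iff, Nat.even_iff]
  exact Iff.rfl

set_option maxRecDepth 100000 in
theorem h_common : ∀ u v : Fin 14, u.val % 2 = v.val % 2 → ∃ w, hAdj u w ∧ hAdj v w := by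
  decide

set_option maxRecDepth 100000 in
theorem h_par : ∀ u v : Fin 14, hAdj u v → u.val % 2 ≠ v.val % 2 := by
  decide

set_option maxRecDepth 100000 in
theorem h_deg : ∀ w : Fin 14, (Finset.univ.filter (fun v => hAdj v w)).card ≤ 3 := by
  decide

theorem h_deg4 (v₁ v₂ v₃ v₄ w : Fin 14) (n12 : v₁ ≠ v₂) (n13 : v₁ ≠ v₃) (n14 : v₁ ≠ v₄)
    (n23 : v₂ ≠ v₃) (n24 : v₂ ≠ v₄) (n34 : v₃ ≠ v₄) (h1 : hAdj v₁ w) (h2 : hAdj v₂ w)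
    (h3 : hAdj v₃ w) (h4 : hAdj v₄ w) : False := by
  have hcard : ({v₁, v₂, v₃, v₄} : Finset (Fin 14)).card = 4 :=
    Finset.card_eq_four.2 ⟨v₁, v₂, v₃, v₄, n12, n13, n14, n23, n24, n34, rfl⟩
  have hsub : ({v₁, v₂, v₃, v₄} : Finset (Fin 14)) ⊆
      Finset.univ.filter (fun v => hAdj v w) := by
    intro x hx
    rw [Finset.mem_filter]
    refine ⟨Finset.mem_univ _, ?_⟩
    rw [Finset.mem_insert, Finset.mem_insert, Finset.mem_insert, Finset.mem_singleton] at hx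
    rcases hx with rfl | rfl | rfl | rfl <;> assumption
  have := Finset.card_le_card hsub
  have := h_deg w
  omega

theorem h_four (a b c d : ℕ) (h : ({a, b, c, d} : Finset ℕ).card = 4) :
    a ≠ b ∧ a ≠ c ∧ a ≠ d ∧ b ≠ c ∧ b ≠ d ∧ c ≠ d := by
  have key : ∀ x y z : ℕ, ({a, b, c, d} : Finset ℕ) ⊆ {x, y, z} → False := by
    intro x y z hs
    have h1 := Finset.card_le_card hs
    have h2 := Finset.card_le_three (a := x) (b := y) (c := z)
    omega
  refine ⟨fun e => key b c d ?_, fun e => key b c d ?_, fun e => key b c d ?_,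
    fun e => key a c d ?_, fun e => key a c d ?_, fun e => key a b d ?_⟩ <;>
  · intro x hx
    simp only [Finset.mem_insert, Finset.mem_singleton] at hx ⊢
    omega

theorem h_disj (f : ZMod 14 → Finset ℕ) (hf : IsTToneColoring heawoodGraph 2 6 f)
    (u v : ZMod 14) (h : hAdj u v) : Disjoint (f u) (f v) := by
  have h' := (hAdj_iff u v).2 h
  have := hf.2 u v h'.ne
  rw [SimpleGraph.edist_eq_one_iff_adj.2 h'] at this
  have h0 : (f u ∩ f v).card < 1 := by exact_mod_cast this
  rw [Finset.disjoint_iff_inter_eq_empty, ← Finset.card_eq_zero]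
  omega

theorem h_inj (f : ZMod 14 → Finset ℕ) (hf : IsTToneColoring heawoodGraph 2 6 f)
    (u v : ZMod 14) (h : u.val % 2 = v.val % 2) (he : f u = f v) : u = v := by
  by_contra hne
  obtain ⟨w, h1, h2⟩ := h_common u v h
  have h1' := (hAdj_iff u w).2 h1
  have h2' := (hAdj_iff v w).2 h2
  have h3 := hf.2 u v hne
  have h4 := SimpleGraph.Walk.edist_le (SimpleGraph.Walk.cons h1' (SimpleGraph.Walk.cons h2'.symm SimpleGraph.Walk.nil))
  rw [he, Finset.inter_self, (hf.1 v).1] at h3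
  exact absurd (lt_of_lt_of_le h3 h4) (lt_irrefl _)

theorem h_line (f : ZMod 14 → Finset ℕ) (hf : IsTToneColoring heawoodGraph 2 6 f)
    (S : Finset ℕ) (hS : S ⊆ Finset.Icc 1 6) (hc : S.card = 4)
    (u v w : ZMod 14) (h1 : hAdj u w) (h2 : hAdj v w) (hu : f u ∪ f v = S) :
    f w = Finset.Icc 1 6 \ S := by
  apply Finset.eq_of_subset_of_card_le
  · rw [Finset.subset_sdiff]
    refine ⟨(hf.1 w).2, ?_⟩
    rw [← hu, Finset.disjoint_union_right]
    exact ⟨(h_disj f hf u w h1).symm, (h_disj f hf v w h2).symm⟩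
  · rw [Finset.card_sdiff_of_subset hS, (hf.1 w).1, hc]
    simp

theorem heawood_no_complementary_pair_in_partite_set
    (f : ZMod 14 → Finset ℕ) (hf : IsTToneColoring heawoodGraph 2 6 f)
    (a b c d : ℕ) (ha : a ∈ Finset.Icc 1 6) (hb : b ∈ Finset.Icc 1 6)
    (hc : c ∈ Finset.Icc 1 6) (hd : d ∈ Finset.Icc 1 6)
    (hdistinct : ({a, b, c, d} : Finset ℕ).card = 4) :
    ¬ ∃ v₁ v₂ v₃ v₄ : ZMod 14,
      ((Even v₁.val ∧ Even v₂.val ∧ Even v₃.val ∧ Even v₄.val) ∨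
        (¬ Even v₁.val ∧ ¬ Even v₂.val ∧ ¬ Even v₃.val ∧ ¬ Even v₄.val)) ∧
      f v₁ = {a, b} ∧ f v₂ = {c, d} ∧ f v₃ = {a, c} ∧ f v₄ = {b, d} := by
  rintro ⟨v₁, v₂, v₃, v₄, hp, e1, e2, e3, e4⟩
  have hpar : v₁.val % 2 = v₂.val % 2 ∧ v₁.val % 2 = v₃.val % 2 ∧ v₁.val % 2 = v₄.val % 2 := by
    simp only [Nat.even_iff] at hp
    omega
  obtain ⟨p2, p3, p4⟩ := hpar
  have hS : ({a, b, c, d} : Finset ℕ) ⊆ Finset.Icc 1 6 := by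
    intro x hx
    simp only [Finset.mem_insert, Finset.mem_singleton] at hx
    rcases hx with rfl | rfl | rfl | rfl <;> assumption
  have hd' : a ≠ b ∧ a ≠ c ∧ a ≠ d ∧ b ≠ c ∧ b ≠ d ∧ c ≠ d := by
    exact h_four a b c d hdistinct
  obtain ⟨ab, ac, ad, bc, bd, cd⟩ := hd'
  obtain ⟨w, hw1, hw2⟩ := h_common v₁ v₂ p2
  obtain ⟨w', hw3, hw4⟩ := h_common v₃ v₄ (p3.symm.trans p4)
  have l1 := h_line f hf _ hS hdistinct v₁ v₂ w hw1 hw2 (by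
    rw [e1, e2]; ext x; simp; tauto)
  have l2 := h_line f hf _ hS hdistinct v₃ v₄ w' hw3 hw4 (by
    rw [e3, e4]; ext x; simp; tauto)
  have q1 := h_par _ _ hw1
  have q3 := h_par _ _ hw3
  have hww : w = w' := by
    refine h_inj f hf w w' ?_ (l1.trans l2.symm)
    change (ZMod.val (n := 14) v₁) % 2 ≠ (ZMod.val (n := 14) w) % 2 at q1
    change (ZMod.val (n := 14) v₃) % 2 ≠ (ZMod.val (n := 14) w') % 2 at q3
    omega
  subst hww
  have key : ∀ (u v : ZMod 14) (x : ℕ), x ∈ f u → x ∉ f v → u ≠ v := by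
    rintro u v x h1 h2 rfl
    exact h2 h1
  have n12 : v₁ ≠ v₂ := key _ _ a (by simp [e1]) (by simp [e2, ac, ad])
  have n13 : v₁ ≠ v₃ := key _ _ b (by simp [e1]) (by simp [e3, ab.symm, bc])
  have n14 : v₁ ≠ v₄ := key _ _ a (by simp [e1]) (by simp [e4, ab, ad])
  have n23 : v₂ ≠ v₃ := key _ _ d (by simp [e2]) (by simp [e3, ad.symm, cd.symm])
  have n24 : v₂ ≠ v₄ := key _ _ c (by simp [e2]) (by simp [e4, bc.symm, cd])
  have n34 : v₃ ≠ v₄ := key _ _ a (by simp [e3]) (by simp [e4, ab, ad])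
  exact h_deg4 v₁ v₂ v₃ v₄ w n12 n13 n14 n23 n24 n34 hw1 hw2 hw3 hw4
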